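/- Generic-step heat bound for the straight-line erasure protocol: Let d ≥ 2 and T ≥ 2 be integers, ε ∈ (0, 1/2], and let ρ be a density matrix on ℂ^d. Let ρ'_ε be the target erasure state, ρ_t (t = 0,…,T) the straight-line erasure path from ρ to ρ'_ε, and βQ := Σ_{t=1}^T Re tr[(ρ_t − ρ_{t−1})·log ρ_t] the dimensionless protocol heat. Then S(ρ) − S(ρ'_ε) ≤ βQ ≤ S(ρ) − S(ρ'_ε) + ln(e·(d−1)²·T/ε)/T. -/

import Mathlib

open Matrix BigOperators
open scoped ComplexOrder

/-- The matrix unit `|e₀⟩⟨e₀|` in the `(0,0)` entry. -/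
noncomputable def E00 (d : ℕ) : Matrix (Fin d) (Fin d) ℂ :=
  Matrix.of fun i j => if (i : ℕ) = 0 ∧ (j : ℕ) = 0 then 1 else 0

/-- The target erasure state `ρ'_ε = (1-ε)·E₀₀ + (ε/(d-1))·(I - E₀₀)`. -/
noncomputable def targetState (d : ℕ) (ε : ℝ) : Matrix (Fin d) (Fin d) ℂ :=
  (1 - ε : ℝ) • E00 d + (ε / ((d : ℝ) - 1)) • (1 - E00 d)

/-- The matrix logarithm of a Hermitian matrix, via its spectral decomposition
(continuous functional calculus applied to `Real.log`); junk value `0` otherwise. -/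
noncomputable def matLog {d : ℕ} (A : Matrix (Fin d) (Fin d) ℂ) :
    Matrix (Fin d) (Fin d) ℂ :=
  if hA : A.IsHermitian then hA.cfc Real.log else 0

/-- The von Neumann entropy `S(ρ) = ∑ᵢ (-λᵢ ln λᵢ)` of a Hermitian matrix. -/
noncomputable def vnEntropy {d : ℕ} (ρ : Matrix (Fin d) (Fin d) ℂ) : ℝ :=
  if hρ : ρ.IsHermitian then ∑ i, Real.negMulLog (hρ.eigenvalues i) else 0

/-- The straight-line erasure path `ρ_t = ρ + (t/T)·(ρ'_ε - ρ)`. -/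
noncomputable def erasurePath {d : ℕ} (ρ : Matrix (Fin d) (Fin d) ℂ) (ε : ℝ)
    (T t : ℕ) : Matrix (Fin d) (Fin d) ℂ :=
  ρ + ((t : ℝ) / (T : ℝ)) • (targetState d ε - ρ)

/-- The dimensionless protocol heat
`βQ = ∑_{t=1}^T Re tr[(ρ_t - ρ_{t-1})·log ρ_t]`. -/
noncomputable def protocolHeat {d : ℕ} (ρ : Matrix (Fin d) (Fin d) ℂ) (ε : ℝ)
    (T : ℕ) : ℝ :=
  ∑ t ∈ Finset.Icc 1 T,
    ((erasurePath ρ ε T t - erasurePath ρ ε T (t - 1)) *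
      matLog (erasurePath ρ ε T t)).trace.re

section
open scoped MatrixOrder Matrix.Norms.L2Operator

lemma matLog_eq {d : ℕ} {A : Matrix (Fin d) (Fin d) ℂ} (hA : A.IsHermitian) :
    matLog A = hA.cfc Real.log := by simp [matLog, hA]

lemma matLog_mono {d : ℕ} {A B : Matrix (Fin d) (Fin d) ℂ} (hA : A.PosDef) (hB : B.IsHermitian)
    (h : (B - A).PosSemidef) : (matLog B - matLog A).PosSemidef := by
  rw [matLog_eq hB, matLog_eq hA.1, ← hB.cfc_eq, ← hA.1.cfc_eq]
  have := CFC.log_le_log (a := A) (b := B) (Matrix.le_iff.2 h) hA.isStrictlyPositive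
  exact Matrix.le_iff.1 this

lemma trace_mul_nonneg {d : ℕ} {A B : Matrix (Fin d) (Fin d) ℂ} (hA : A.PosSemidef)
    (hB : B.PosSemidef) : 0 ≤ (A * B).trace.re := by
  obtain ⟨C, rfl⟩ := CStarAlgebra.nonneg_iff_eq_star_mul_self.1 (Matrix.nonneg_iff_posSemidef.2 hA)
  rw [Matrix.mul_assoc, Matrix.trace_mul_comm]
  have := (hB.mul_mul_conjTranspose_same C).trace_nonneg
  exact (Complex.le_def.1 this).1

/-- Two-basis trace formula. -/
lemma exists_weights {d : ℕ} {A B : Matrix (Fin d) (Fin d) ℂ} (hA : A.IsHermitian)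
    (hB : B.IsHermitian) : ∃ p : Fin d → Fin d → ℝ, (∀ i j, 0 ≤ p i j) ∧
      (∀ i, ∑ j, p i j = 1) ∧ (∀ j, ∑ i, p i j = 1) ∧
      ∀ f : ℝ → ℝ, (A * hB.cfc f).trace.re =
        ∑ i, ∑ j, p i j * (hA.eigenvalues i * f (hB.eigenvalues j)) := by
  set U : Matrix (Fin d) (Fin d) ℂ := (hA.eigenvectorUnitary).1 with hU
  set V : Matrix (Fin d) (Fin d) ℂ := (hB.eigenvectorUnitary).1 with hV
  have hUU : star U * U = 1 := Unitary.coe_star_mul_self _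
  have hUU' : U * star U = 1 := Unitary.coe_mul_star_self _
  have hVV : star V * V = 1 := Unitary.coe_star_mul_self _
  have hVV' : V * star V = 1 := Unitary.coe_mul_star_self _
  set W := star U * V with hW
  have h1 : W * star W = 1 := by
    rw [hW, star_mul, star_star, Matrix.mul_assoc, ← Matrix.mul_assoc V, hVV', Matrix.one_mul, hUU]
  have h2 : star W * W = 1 := by
    rw [hW, star_mul, star_star, Matrix.mul_assoc, ← Matrix.mul_assoc U, hUU', Matrix.one_mul, hVV]
  refine ⟨fun i j => Complex.normSq (W i j), fun i j => Complex.normSq_nonneg _, ?_, ?_, ?_⟩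
  · intro i
    have := congrFun (congrFun h1 i) i
    simp only [Matrix.mul_apply, Matrix.star_apply, Matrix.one_apply_eq, Complex.star_def,
      Complex.mul_conj] at this
    exact_mod_cast this
  · intro j
    have := congrFun (congrFun h2 j) j
    simp only [Matrix.mul_apply, Matrix.star_apply, Matrix.one_apply_eq, Complex.star_def,
      ← Complex.normSq_eq_conj_mul_self] at this
    exact_mod_cast this
  · intro f
    have hs : A = U * diagonal (RCLike.ofReal ∘ hA.eigenvalues) * star U := hA.spectral_theorem
    have hc : hB.cfc f = V * diagonal (RCLike.ofReal ∘ f ∘ hB.eigenvalues) * star V := rfl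
    rw [hc]
    conv_lhs => rw [hs]
    set D : Matrix (Fin d) (Fin d) ℂ := diagonal (RCLike.ofReal ∘ hA.eigenvalues) with hD
    set E : Matrix (Fin d) (Fin d) ℂ := diagonal (RCLike.ofReal ∘ f ∘ hB.eigenvalues) with hE
    have : (U * D * star U * (V * E * star V)).trace = (D * W * (E * star W)).trace := by
      rw [Matrix.mul_assoc, Matrix.mul_assoc, Matrix.trace_mul_comm, hW, star_mul, star_star]
      simp only [Matrix.mul_assoc]
    rw [this, Matrix.trace, Complex.re_sum]
    refine Finset.sum_congr rfl fun i _ => ?_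
    rw [Matrix.diag_apply, Matrix.mul_apply, Complex.re_sum]
    refine Finset.sum_congr rfl fun j _ => ?_
    rw [hD, hE, Matrix.diagonal_mul, Matrix.diagonal_mul, Matrix.star_apply]
    have : ((RCLike.ofReal ∘ hA.eigenvalues) i : ℂ) * W i j *
      ((RCLike.ofReal ∘ f ∘ hB.eigenvalues) j * star (W i j)) =
      ((Complex.normSq (W i j) * (hA.eigenvalues i * f (hB.eigenvalues j)) : ℝ) : ℂ) := by
      push_cast
      rw [← Complex.mul_conj]
      simp
      ring
    rw [this, Complex.ofReal_re]

lemma trace_mul_cfc_self {d : ℕ} {A : Matrix (Fin d) (Fin d) ℂ} (hA : A.IsHermitian)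
    (f : ℝ → ℝ) : (A * hA.cfc f).trace.re = ∑ i, hA.eigenvalues i * f (hA.eigenvalues i) := by
  have hs : hA.cfc id = A := hA.spectral_theorem.symm
  have h : hA.cfc id * hA.cfc f = hA.cfc (fun x => x * f x) := by
    simp only [Matrix.IsHermitian.cfc, ← map_mul, Matrix.diagonal_mul_diagonal]
    congr 2
    ext i; simp
  rw [hs] at h
  rw [h, Matrix.IsHermitian.cfc, Unitary.conjStarAlgAut_apply, Matrix.trace_mul_comm,
    ← Matrix.mul_assoc, Unitary.coe_star_mul_self, Matrix.one_mul, Matrix.trace_diagonal,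
    Complex.re_sum]
  refine Finset.sum_congr rfl fun i _ => ?_
  exact Complex.ofReal_re _

lemma trace_mul_matLog_self {d : ℕ} {A : Matrix (Fin d) (Fin d) ℂ} (hA : A.IsHermitian) :
    (A * matLog A).trace.re = - vnEntropy A := by
  rw [matLog_eq hA, trace_mul_cfc_self hA, vnEntropy, dif_pos hA, ← Finset.sum_neg_distrib]
  simp [Real.negMulLog]

lemma sum_eig {d : ℕ} {A : Matrix (Fin d) (Fin d) ℂ} (hA : A.IsHermitian) (h : A.trace = 1) :
    ∑ i, hA.eigenvalues i = 1 := by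
  have := hA.trace_eq_sum_eigenvalues
  rw [h] at this
  have h2 := congrArg Complex.re this
  rw [Complex.re_sum] at h2
  simpa using h2.symm

lemma eig_le_one {d : ℕ} {A : Matrix (Fin d) (Fin d) ℂ} (hA : A.PosSemidef) (h : A.trace = 1)
    (i : Fin d) : hA.1.eigenvalues i ≤ 1 := by
  rw [← sum_eig hA.1 h]
  exact Finset.single_le_sum (fun i _ => hA.eigenvalues_nonneg i) (Finset.mem_univ i)

lemma vnEntropy_nonneg {d : ℕ} {A : Matrix (Fin d) (Fin d) ℂ} (hA : A.PosSemidef)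
    (h : A.trace = 1) : 0 ≤ vnEntropy A := by
  rw [vnEntropy, dif_pos hA.1]
  exact Finset.sum_nonneg fun i _ =>
    Real.negMulLog_nonneg (hA.eigenvalues_nonneg i) (eig_le_one hA h i)

/-- Klein's inequality. -/
lemma klein {d : ℕ} {A B : Matrix (Fin d) (Fin d) ℂ} (hA : A.PosSemidef) (hB : B.PosDef)
    (hAt : A.trace = 1) (hBt : B.trace = 1) : (A * matLog B).trace.re ≤ - vnEntropy A := by
  obtain ⟨p, p0, p1, p2, hp⟩ := exists_weights hA.1 hB.1
  rw [matLog_eq hB.1, hp, vnEntropy, dif_pos hA.1]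
  have e1 : ∑ i, ∑ j, p i j * hA.1.eigenvalues i = 1 := by
    simp_rw [← Finset.sum_mul, p1, one_mul]; exact sum_eig hA.1 hAt
  have e2 : ∑ i, ∑ j, p i j * hB.1.eigenvalues j = 1 := by
    rw [Finset.sum_comm]
    simp_rw [← Finset.sum_mul, p2, one_mul]; exact sum_eig hB.1 hBt
  have e3 : ∑ i, ∑ j, p i j * Real.negMulLog (hA.1.eigenvalues i) =
      ∑ i, Real.negMulLog (hA.1.eigenvalues i) := by
    simp_rw [← Finset.sum_mul, p1, one_mul]
  have key : ∑ i, ∑ j, (p i j * (hA.1.eigenvalues i * Real.log (hB.1.eigenvalues j)) +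
      p i j * Real.negMulLog (hA.1.eigenvalues i)) ≤
      ∑ i, ∑ j, (p i j * hB.1.eigenvalues j - p i j * hA.1.eigenvalues i) := by
    refine Finset.sum_le_sum fun i _ => Finset.sum_le_sum fun j _ => ?_
    rw [← mul_add, ← mul_sub]
    refine mul_le_mul_of_nonneg_left ?_ (p0 i j)
    have ha := hA.eigenvalues_nonneg i
    have hb := hB.eigenvalues_pos j
    rcases ha.eq_or_lt with h0 | h0
    · rw [← h0]; simp; exact hb.le
    · have := Real.log_le_sub_one_of_pos (div_pos hb h0)
      rw [Real.log_div hb.ne' h0.ne'] at this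
      have := mul_le_mul_of_nonneg_left this h0.le
      rw [mul_sub, mul_sub, mul_div_cancel₀ _ h0.ne'] at this
      simp only [Real.negMulLog]
      linarith
  simp only [Finset.sum_add_distrib, Finset.sum_sub_distrib] at key
  linarith

lemma lower {d : ℕ} {A B : Matrix (Fin d) (Fin d) ℂ} (hA : A.PosSemidef) (hB : B.IsHermitian)
    (c δ : ℝ) (hC : (c • A + δ • (1 : Matrix (Fin d) (Fin d) ℂ)).PosDef)
    (h : (B - (c • A + δ • (1 : Matrix (Fin d) (Fin d) ℂ))).PosSemidef) :
    ∑ i, hA.1.eigenvalues i * Real.log (c * hA.1.eigenvalues i + δ) ≤ (A * matLog B).trace.re := by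
  have h1 := trace_mul_nonneg hA (matLog_mono hC hB h)
  have h2 : matLog (c • A + δ • (1 : Matrix (Fin d) (Fin d) ℂ)) =
      hA.1.cfc (fun x => Real.log (c * x + δ)) := by
    have hsa : IsSelfAdjoint A := hA.1
    rw [matLog_eq hC.1, ← hC.1.cfc_eq, ← hA.1.cfc_eq]
    have hfin : ∀ s : Set ℝ, s.Finite → ∀ f : ℝ → ℝ, ContinuousOn f s := fun s hs f => hs.continuousOn f
    have e : c • A + δ • (1 : Matrix (Fin d) (Fin d) ℂ) = cfc (fun x : ℝ => c * x + δ) A := by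
      rw [cfc_add .., cfc_const_mul .., cfc_id' ℝ A, cfc_const .., Algebra.algebraMap_eq_smul_one]
    rw [e, ← cfc_comp' Real.log (fun x : ℝ => c * x + δ) A
      (hfin _ (Matrix.finite_real_spectrum.image _) _)]
  rw [Matrix.mul_sub, Matrix.trace_sub, Complex.sub_re, h2, trace_mul_cfc_self] at h1
  linarith

lemma psd_smul {d : ℕ} {A : Matrix (Fin d) (Fin d) ℂ} (hA : A.PosSemidef) {r : ℝ} (hr : 0 ≤ r) :
    (r • A).PosSemidef := hA.smul hr

lemma pd_smul {d : ℕ} {A : Matrix (Fin d) (Fin d) ℂ} (hA : A.PosDef) {r : ℝ} (hr : 0 < r) :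
    (r • A).PosDef := hA.smul hr

lemma E00_psd (d : ℕ) : (E00 d).PosSemidef := by
  have : E00 d = diagonal (fun i : Fin d => if (i : ℕ) = 0 then (1 : ℂ) else 0) := by
    ext i j
    simp only [E00, Matrix.of_apply, Matrix.diagonal_apply, Fin.ext_iff]
    split_ifs <;> first | rfl | omega
  rw [this]
  refine Matrix.PosSemidef.diagonal ?_
  intro i
  simp only [Pi.zero_apply]
  split_ifs <;> simp

lemma E00_trace {d : ℕ} (hd : 2 ≤ d) : (E00 d).trace = 1 := by
  rw [Matrix.trace, Finset.sum_eq_single (⟨0, by omega⟩ : Fin d)]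
  · simp [E00]
  · intro b _ hb
    have : (b : ℕ) ≠ 0 := fun h => hb (Fin.ext h)
    simp [E00, this]
  · simp

lemma target_sub {d : ℕ} (hd : 2 ≤ d) {ε : ℝ} (hε : ε ∈ Set.Ioc (0 : ℝ) (1 / 2)) :
    (targetState d ε - (ε / ((d : ℝ) - 1)) • (1 : Matrix (Fin d) (Fin d) ℂ)).PosSemidef := by
  have h1 : (1 : ℝ) ≤ (d : ℝ) - 1 := by
    have : (2 : ℝ) ≤ d := by exact_mod_cast hd
    linarith
  have h2 : ε / ((d : ℝ) - 1) ≤ ε := div_le_self hε.1.le h1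
  have : targetState d ε - (ε / ((d : ℝ) - 1)) • (1 : Matrix (Fin d) (Fin d) ℂ) =
      (1 - ε - ε / ((d : ℝ) - 1)) • E00 d := by
    rw [targetState]; module
  rw [this]
  exact psd_smul (E00_psd d) (by linarith [hε.2])

lemma target_trace {d : ℕ} (hd : 2 ≤ d) (ε : ℝ) : (targetState d ε).trace = 1 := by
  have h1 : (d : ℂ) - 1 ≠ 0 := by
    intro h
    have : (d : ℂ) = (1 : ℕ) := by push_cast; linear_combination h
    have := Nat.cast_injective this
    omega
  rw [targetState, Matrix.trace_add, Matrix.trace_smul, Matrix.trace_smul, Matrix.trace_sub,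
    E00_trace hd, Matrix.trace_one, Fintype.card_fin, Complex.real_smul, Complex.real_smul]
  push_cast
  field_simp
  ring

lemma heat_general {d : ℕ} (T : ℕ) (hT : 2 ≤ T) (m : ℝ) (hm : 0 < m)
    (ρ σ : Matrix (Fin d) (Fin d) ℂ) (hρ : ρ.PosSemidef) (hρt : ρ.trace = 1)
    (hσt : σ.trace = 1) (hσm : (σ - m • (1 : Matrix (Fin d) (Fin d) ℂ)).PosSemidef)
    (P : ℕ → Matrix (Fin d) (Fin d) ℂ) (hP : ∀ t, P t = ρ + ((t : ℝ) / (T : ℝ)) • (σ - ρ)) :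
    vnEntropy ρ - vnEntropy σ ≤ ∑ t ∈ Finset.Icc 1 T, ((P t - P (t - 1)) * matLog (P t)).trace.re ∧
    ∑ t ∈ Finset.Icc 1 T, ((P t - P (t - 1)) * matLog (P t)).trace.re ≤
      vnEntropy ρ - vnEntropy σ + (1 + Real.log T - Real.log m) / T := by
  have hT0 : (2 : ℝ) ≤ T := by exact_mod_cast hT
  have hTp : (0 : ℝ) < T := by linarith
  have hinv : 0 < 1 / (T : ℝ) := by positivity
  have hinv1 : 1 / (T : ℝ) < 1 := by rw [div_lt_one hTp]; linarith
  have hone : (m • (1 : Matrix (Fin d) (Fin d) ℂ)).PosDef := pd_smul Matrix.PosDef.one hm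
  have hσ : σ.PosDef := by
    have := hone.add_posSemidef hσm
    simpa using this
  have hP' : ∀ t, P t = (1 - (t : ℝ) / T) • ρ + ((t : ℝ) / T) • σ := fun t => by
    rw [hP]; module
  have hfrac : ∀ t, t ≤ T → (t : ℝ) / T ≤ 1 := fun t ht => by
    rw [div_le_one hTp]; exact_mod_cast ht
  have hPpd : ∀ t, 1 ≤ t → t ≤ T → (P t).PosDef := fun t h1 ht => by
    rw [hP']
    have : (0 : ℝ) < t := by exact_mod_cast h1
    exact Matrix.PosDef.posSemidef_add (psd_smul hρ (by linarith [hfrac t ht]))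
      (pd_smul hσ (by positivity))
  have hPt : ∀ t, (P t).trace = 1 := fun t => by
    rw [hP, Matrix.trace_add, Matrix.trace_smul, Matrix.trace_sub, hρt, hσt]; simp
  have hP0 : P 0 = ρ := by rw [hP]; simp
  have hPT : P T = σ := by rw [hP, div_self hTp.ne']; simp
  have hPpsd : ∀ t, t ≤ T → (P t).PosSemidef := fun t ht => by
    rcases Nat.eq_zero_or_pos t with h | h
    · rw [h, hP0]; exact hρ
    · exact (hPpd t h ht).posSemidef
  have hstep : ∀ t, P (t + 1) - P t = (1 / (T : ℝ)) • (σ - ρ) := fun t => by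
    rw [hP, hP]; push_cast; rw [add_div]; module
  have hsum : ∑ t ∈ Finset.Icc 1 T, ((P t - P (t - 1)) * matLog (P t)).trace.re =
      ∑ t ∈ Finset.range T, ((P (t + 1) - P t) * matLog (P (t + 1))).trace.re := by
    have h := Finset.sum_Ico_add' (fun t => ((P t - P (t - 1)) * matLog (P t)).trace.re) 0 T 1
    simp only [Nat.add_sub_cancel] at h
    rw [Finset.range_eq_Ico, h]
    rfl
  rw [hsum]
  constructor
  · have : vnEntropy ρ - vnEntropy σ =
        ∑ t ∈ Finset.range T, (vnEntropy (P t) - vnEntropy (P (t + 1))) := by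
      rw [Finset.sum_range_sub', hP0, hPT]
    rw [this]
    refine Finset.sum_le_sum fun t ht => ?_
    have ht := Finset.mem_range.1 ht
    have hpd := hPpd (t + 1) (by omega) (by omega)
    rw [Matrix.sub_mul, Matrix.trace_sub, Complex.sub_re, trace_mul_matLog_self hpd.1]
    linarith [klein (hPpsd t (by omega)) hpd (hPt _) (hPt _)]
  · obtain ⟨n, rfl⟩ : ∃ n, T = n + 1 := ⟨T - 1, by omega⟩
    rw [Finset.sum_range_succ]
    have h1 : ∑ t ∈ Finset.range n, ((P (t + 1) - P t) * matLog (P (t + 1))).trace.re ≤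
        vnEntropy (P 1) - vnEntropy σ := by
      have : vnEntropy (P 1) - vnEntropy σ =
        ∑ t ∈ Finset.range n, (vnEntropy (P (t + 1)) - vnEntropy (P (t + 1 + 1))) := by
        rw [Finset.sum_range_sub' (fun t => vnEntropy (P (t + 1))), hPT]
      rw [this]
      refine Finset.sum_le_sum fun t ht => ?_
      have ht := Finset.mem_range.1 ht
      have hpd := hPpd (t + 1) (by omega) (by omega)
      rw [hstep t, ← hstep (t + 1), Matrix.sub_mul, Matrix.trace_sub, Complex.sub_re,
        trace_mul_matLog_self hpd.1]
      linarith [klein (hPpsd (t + 1 + 1) (by omega)) hpd (hPt _) (hPt _)]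
    set T : ℕ := n + 1 with hTdef
    have h2 : ((P T - P n) * matLog (P T)).trace.re =
        1 / (T : ℝ) * (- vnEntropy σ - (ρ * matLog σ).trace.re) := by
      rw [hTdef, hstep n, ← hTdef, hPT, Matrix.smul_mul, Matrix.trace_smul, Complex.smul_re,
        Matrix.sub_mul, Matrix.trace_sub, Complex.sub_re, trace_mul_matLog_self hσ.1, smul_eq_mul]
    have h3 : Real.log m ≤ (ρ * matLog σ).trace.re := by
      have := lower hρ hσ.1 0 m (by simpa using hone) (by simpa using hσm)
      simpa [← Finset.sum_mul, sum_eig hρ.1 hρt] using this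
    have hpd1 := hPpd 1 le_rfl (by omega)
    have e1 : P 1 = (1 - 1 / (T : ℝ)) • ρ + (1 / (T : ℝ)) • σ := by
      rw [hP']; simp
    have h4 : vnEntropy (P 1) = - ((1 - 1 / (T : ℝ)) * (ρ * matLog (P 1)).trace.re
        + 1 / (T : ℝ) * (σ * matLog (P 1)).trace.re) := by
      have := trace_mul_matLog_self hpd1.1
      have h' : (P 1 * matLog (P 1)).trace.re = (1 - 1 / (T : ℝ)) * (ρ * matLog (P 1)).trace.re
        + 1 / (T : ℝ) * (σ * matLog (P 1)).trace.re := by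
        generalize matLog (P 1) = L
        rw [e1, Matrix.add_mul, Matrix.trace_add, Complex.add_re, Matrix.smul_mul, Matrix.smul_mul,
          Matrix.trace_smul, Matrix.trace_smul, Complex.smul_re, Complex.smul_re, smul_eq_mul,
          smul_eq_mul]
      linarith
    -- general scalar estimate
    have hsc : ∀ {A : Matrix (Fin d) (Fin d) ℂ} (hA : A.PosSemidef) (_ : A.trace = 1) (c δ : ℝ)
        (_ : 0 < c) (_ : 0 ≤ δ), Real.log c - vnEntropy A ≤
        ∑ i, hA.1.eigenvalues i * Real.log (c * hA.1.eigenvalues i + δ) := by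
      intro A hA hAt c δ hc hδ
      have : Real.log c - vnEntropy A = ∑ i, (hA.1.eigenvalues i * Real.log c -
          Real.negMulLog (hA.1.eigenvalues i)) := by
        rw [Finset.sum_sub_distrib, ← Finset.sum_mul, sum_eig hA.1 hAt, one_mul, vnEntropy,
          dif_pos hA.1]
      rw [this]
      refine Finset.sum_le_sum fun i _ => ?_
      have h0 := hA.eigenvalues_nonneg i
      rcases h0.eq_or_lt with h | h
      · rw [← h]; simp
      · have : Real.log (c * hA.1.eigenvalues i) ≤ Real.log (c * hA.1.eigenvalues i + δ) :=
          Real.log_le_log (by positivity) (by linarith)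
        rw [Real.log_mul hc.ne' h.ne'] at this
        have := mul_le_mul_of_nonneg_left this h.le
        rw [Real.negMulLog]
        linarith
    have h5 : Real.log (1 / (T : ℝ)) - vnEntropy σ ≤ (σ * matLog (P 1)).trace.re := by
      refine (hsc hσ.posSemidef hσt (1 / (T : ℝ)) 0 hinv le_rfl).trans
        (lower hσ.posSemidef hpd1.1 _ _ ?_ ?_)
      · simpa using pd_smul hσ hinv
      · rw [e1]
        have := psd_smul hρ (r := 1 - 1 / (T : ℝ)) (by linarith)
        convert this using 1
        module
    have h6 : Real.log (1 - 1 / (T : ℝ)) - vnEntropy ρ ≤ (ρ * matLog (P 1)).trace.re := by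
      refine (hsc hρ hρt (1 - 1 / (T : ℝ)) (1 / (T : ℝ) * m) (by linarith) (by positivity)).trans
        (lower hρ hpd1.1 _ _ ?_ ?_)
      · exact Matrix.PosDef.posSemidef_add (psd_smul hρ (by linarith))
          (pd_smul Matrix.PosDef.one (by positivity))
      · rw [e1]
        have := psd_smul hσm (r := 1 / (T : ℝ)) hinv.le
        convert this using 1
        module
    have h7 : -(1 / (T : ℝ)) ≤ (1 - 1 / (T : ℝ)) * Real.log (1 - 1 / (T : ℝ)) := by
      have hx : 0 < 1 - 1 / (T : ℝ) := by linarith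
      have := Real.one_sub_inv_le_log_of_pos hx
      have := mul_le_mul_of_nonneg_left this hx.le
      rw [mul_sub, mul_inv_cancel₀ hx.ne'] at this
      linarith
    have h8 := vnEntropy_nonneg hρ hρt
    have h5' := mul_le_mul_of_nonneg_left h5 hinv.le
    have h6' := mul_le_mul_of_nonneg_left h6 (show 0 ≤ 1 - 1 / (T : ℝ) by linarith)
    have h3' := mul_le_mul_of_nonneg_left h3 hinv.le
    have h8' := mul_nonneg hinv.le h8
    have hlog : Real.log (1 / (T : ℝ)) = - Real.log T := by simp
    rw [hlog] at h5'
    rw [h2]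
    have hgoal : (1 + Real.log T - Real.log m) / (T : ℝ) =
      1 / (T : ℝ) * (1 + Real.log T - Real.log m) := by ring
    rw [hgoal]
    linarith

end

/-- **Generic-step heat bound for the straight-line erasure protocol.** -/
theorem generic_step_heat_bound
    (d : ℕ) (hd : 2 ≤ d) (T : ℕ) (hT : 2 ≤ T) (ε : ℝ)
    (hε : ε ∈ Set.Ioc (0 : ℝ) (1 / 2))
    (ρ : Matrix (Fin d) (Fin d) ℂ) (hρ : ρ.PosSemidef) (htr : ρ.trace = 1) :
    vnEntropy ρ - vnEntropy (targetState d ε) ≤ protocolHeat ρ ε T ∧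
    protocolHeat ρ ε T ≤ vnEntropy ρ - vnEntropy (targetState d ε) +
      Real.log (Real.exp 1 * ((d : ℝ) - 1) ^ 2 * (T : ℝ) / ε) / (T : ℝ) := by
  have h1 : (1 : ℝ) ≤ (d : ℝ) - 1 := by
    have : (2 : ℝ) ≤ d := by exact_mod_cast hd
    linarith
  have hε0 := hε.1
  have hTp : (0 : ℝ) < T := by
    have : 0 < T := by omega
    exact_mod_cast this
  obtain ⟨hl, hu⟩ := heat_general T hT (ε / ((d : ℝ) - 1)) (div_pos hε.1 (by linarith)) ρ
    (targetState d ε) hρ htr (target_trace hd ε) (target_sub hd hε) (erasurePath ρ ε T)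
    (fun t => rfl)
  refine ⟨hl, hu.trans ?_⟩
  have hd1 : (0 : ℝ) < (d : ℝ) - 1 := by linarith
  have hlog0 : 0 ≤ Real.log ((d : ℝ) - 1) := Real.log_nonneg h1
  have e : Real.log (Real.exp 1 * ((d : ℝ) - 1) ^ 2 * (T : ℝ) / ε) =
      1 + 2 * Real.log ((d : ℝ) - 1) + Real.log T - Real.log ε := by
    rw [Real.log_div (by positivity) hε0.ne', Real.log_mul (by positivity) hTp.ne',
      Real.log_mul (by positivity) (by positivity), Real.log_exp, Real.log_pow]
    push_cast
    ring
  rw [e, Real.log_div hε0.ne' hd1.ne']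
  have := div_le_div_of_nonneg_right (a := 1 + Real.log T - (Real.log ε - Real.log ((d : ℝ) - 1)))
    (b := 1 + 2 * Real.log ((d : ℝ) - 1) + Real.log T - Real.log ε) (by linarith) hTp.le
  linarith
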